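/- Assume the tube is untwisted, i.e. θ is constant on ℝ or ω is invariant under every rotation about the origin. Then no Hardy inequality holds: for every c > 0 there exists ψ ∈ C_c^∞(Ω₀) with Q_θ[ψ] − E₁ ∫_{Ω₀} |ψ(x)|² dx < c ∫_{Ω₀} (1+x₁²)^{−1} |ψ(x)|² dx. -/

import Mathlib

open MeasureTheory Real Set Filter

noncomputable section

/-- First partial derivative ∂₁ of a function on ℝ³ = ℝ × ℝ × ℝ. -/
def pd1 {E : Type*} [NormedAddCommGroup E] [NormedSpace ℝ E]
    (ψ : ℝ × ℝ × ℝ → E) (x : ℝ × ℝ × ℝ) : E :=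
  deriv (fun t => ψ (t, x.2.1, x.2.2)) x.1

/-- Second partial derivative ∂₂. -/
def pd2 {E : Type*} [NormedAddCommGroup E] [NormedSpace ℝ E]
    (ψ : ℝ × ℝ × ℝ → E) (x : ℝ × ℝ × ℝ) : E :=
  deriv (fun t => ψ (x.1, t, x.2.2)) x.2.1

/-- Third partial derivative ∂₃. -/
def pd3 {E : Type*} [NormedAddCommGroup E] [NormedSpace ℝ E]
    (ψ : ℝ × ℝ × ℝ → E) (x : ℝ × ℝ × ℝ) : E :=
  deriv (fun t => ψ (x.1, x.2.1, t)) x.2.2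

/-- Transverse angular derivative ∂_τ = x₃∂₂ − x₂∂₃. -/
def pdtau {E : Type*} [NormedAddCommGroup E] [NormedSpace ℝ E]
    (ψ : ℝ × ℝ × ℝ → E) (x : ℝ × ℝ × ℝ) : E :=
  x.2.2 • pd2 ψ x - x.2.1 • pd3 ψ x

/-- The straight tube Ω₀ = ℝ × ω. -/
def Omega0 (ω : Set (ℝ × ℝ)) : Set (ℝ × ℝ × ℝ) := {x | x.2 ∈ ω}

/-- Smooth compactly supported test functions with support in Ω (i.e. C_c^∞(Ω)). -/
def IsTest3 {E : Type*} [NormedAddCommGroup E] [NormedSpace ℝ E]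
    (Ω : Set (ℝ × ℝ × ℝ)) (ψ : ℝ × ℝ × ℝ → E) : Prop :=
  ContDiff ℝ (⊤ : ℕ∞) ψ ∧ HasCompactSupport ψ ∧ tsupport ψ ⊆ Ω

/-- Partial derivatives on ℝ². -/
def pd1' (f : ℝ × ℝ → ℂ) (p : ℝ × ℝ) : ℂ := deriv (fun t => f (t, p.2)) p.1

def pd2' (f : ℝ × ℝ → ℂ) (p : ℝ × ℝ) : ℂ := deriv (fun t => f (p.1, t)) p.2

/-- Smooth compactly supported test functions on the cross-section, C_c^∞(ω). -/
def IsTest2 (ω : Set (ℝ × ℝ)) (f : ℝ × ℝ → ℂ) : Prop :=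
  ContDiff ℝ (⊤ : ℕ∞) f ∧ HasCompactSupport f ∧ tsupport f ⊆ ω

/-- The lowest Dirichlet eigenvalue E₁ of −Δ on ω, defined variationally. -/
def E1 (ω : Set (ℝ × ℝ)) : ℝ :=
  sInf { r : ℝ | ∃ f : ℝ × ℝ → ℂ, IsTest2 ω f ∧ f ≠ 0 ∧
    r = (∫ p in ω, (‖pd1' f p‖ ^ 2 + ‖pd2' f p‖ ^ 2)) / ∫ p in ω, ‖f p‖ ^ 2 }

/-- The twisted quadratic form Q_θ[ψ] = ∫_{Ω₀} (|∂₁ψ − θ̇ ∂_τψ|² + |∇'ψ|²). -/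
def Qform (θ : ℝ → ℝ) (ω : Set (ℝ × ℝ)) (ψ : ℝ × ℝ × ℝ → ℂ) : ℝ :=
  ∫ x in Omega0 ω,
    (‖pd1 ψ x - deriv θ x.1 • pdtau ψ x‖ ^ 2 + ‖pd2 ψ x‖ ^ 2 + ‖pd3 ψ x‖ ^ 2)

/-- Rotation of the plane by angle ϑ about the origin. -/
def rot (ϑ : ℝ) (p : ℝ × ℝ) : ℝ × ℝ :=
  (p.1 * Real.cos ϑ + p.2 * Real.sin ϑ, -p.1 * Real.sin ϑ + p.2 * Real.cos ϑ)

/-- The tube is twisted: θ is not constant and ω is not rotationally symmetric about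
the origin (in the strong sense: some rotated copy of ω differs from ω on a set of
positive Lebesgue measure). -/
def Twisted (θ : ℝ → ℝ) (ω : Set (ℝ × ℝ)) : Prop :=
  (∃ s t : ℝ, θ s ≠ θ t) ∧
  (∃ ϑ ∈ Set.Ioo (0 : ℝ) (2 * Real.pi), volume (symmDiff (rot ϑ '' ω) ω) ≠ 0)

/-- The tube is untwisted: θ is constant or ω is invariant under every rotation
about the origin. -/
def Untwisted (θ : ℝ → ℝ) (ω : Set (ℝ × ℝ)) : Prop :=
  (∀ s t : ℝ, θ s = θ t) ∨ (∀ ϑ : ℝ, rot ϑ '' ω = ω)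

theorem pd1'_eq_fderiv {f : ℝ × ℝ → ℂ} {p : ℝ × ℝ} (hf : DifferentiableAt ℝ f p) :
    pd1' f p = fderiv ℝ f p (1, 0) := by
  have h : HasDerivAt (fun t : ℝ => (t, p.2)) ((1 : ℝ), (0 : ℝ)) p.1 :=
    (hasDerivAt_id _).prodMk (hasDerivAt_const _ _)
  exact (HasFDerivAt.comp_hasDerivAt p.1 (f := fun t : ℝ => (t, p.2)) hf.hasFDerivAt h).deriv

theorem pd2'_eq_fderiv {f : ℝ × ℝ → ℂ} {p : ℝ × ℝ} (hf : DifferentiableAt ℝ f p) :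
    pd2' f p = fderiv ℝ f p (0, 1) := by
  have h : HasDerivAt (fun t : ℝ => (p.1, t)) ((0 : ℝ), (1 : ℝ)) p.2 :=
    (hasDerivAt_const _ _).prodMk (hasDerivAt_id _)
  exact (HasFDerivAt.comp_hasDerivAt p.2 (f := fun t : ℝ => (p.1, t)) hf.hasFDerivAt h).deriv

theorem fderiv_apply_eq_pd {f : ℝ × ℝ → ℂ} {p : ℝ × ℝ} (hf : DifferentiableAt ℝ f p)
    (a b : ℝ) : fderiv ℝ f p (a, b) = a • pd1' f p + b • pd2' f p := by
  rw [pd1'_eq_fderiv hf, pd2'_eq_fderiv hf, ← map_smul, ← map_smul, ← map_add]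
  simp

/-- The planar angular derivative `x₂∂₁ - x₁∂₂`. -/
def pdtau' (f : ℝ × ℝ → ℂ) (p : ℝ × ℝ) : ℂ := p.2 • pd1' f p - p.1 • pd2' f p

theorem pd1'_eq_fderiv_fun {f : ℝ × ℝ → ℂ} (hf : Differentiable ℝ f) :
    pd1' f = fun p => fderiv ℝ f p (1, 0) := funext fun p => pd1'_eq_fderiv (hf p)

theorem pd2'_eq_fderiv_fun {f : ℝ × ℝ → ℂ} (hf : Differentiable ℝ f) :
    pd2' f = fun p => fderiv ℝ f p (0, 1) := funext fun p => pd2'_eq_fderiv (hf p)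

section TestFunctions

variable {ω : Set (ℝ × ℝ)} {f : ℝ × ℝ → ℂ}

theorem IsTest2.differentiable (hf : IsTest2 ω f) : Differentiable ℝ f :=
  hf.1.differentiable (by simp)

theorem IsTest2.continuous_pd1' (hf : IsTest2 ω f) : Continuous (pd1' f) := by
  rw [pd1'_eq_fderiv_fun hf.differentiable]
  exact (hf.1.continuous_fderiv (by simp)).clm_apply continuous_const

theorem IsTest2.continuous_pd2' (hf : IsTest2 ω f) : Continuous (pd2' f) := by
  rw [pd2'_eq_fderiv_fun hf.differentiable]
  exact (hf.1.continuous_fderiv (by simp)).clm_apply continuous_const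

theorem IsTest2.continuous_pdtau' (hf : IsTest2 ω f) : Continuous (pdtau' f) :=
  (continuous_snd.smul hf.continuous_pd1').sub (continuous_fst.smul hf.continuous_pd2')

theorem IsTest2.hasCompactSupport_pd1' (hf : IsTest2 ω f) : HasCompactSupport (pd1' f) := by
  rw [pd1'_eq_fderiv_fun hf.differentiable]
  exact hf.2.1.fderiv_apply ℝ _

theorem IsTest2.hasCompactSupport_pd2' (hf : IsTest2 ω f) : HasCompactSupport (pd2' f) := by
  rw [pd2'_eq_fderiv_fun hf.differentiable]
  exact hf.2.1.fderiv_apply ℝ _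

theorem IsTest2.hasCompactSupport_pdtau' (hf : IsTest2 ω f) :
    HasCompactSupport (pdtau' f) := by
  have h1 := hf.hasCompactSupport_pd1'.smul_left (f := fun p : ℝ × ℝ => p.2)
  have h2 := hf.hasCompactSupport_pd2'.smul_left (f := fun p : ℝ × ℝ => p.1)
  exact h1.sub h2

end TestFunctions

theorem integrable_norm_sq {X E : Type*} [TopologicalSpace X] [MeasurableSpace X]
    [OpensMeasurableSpace X] {μ : Measure X} [IsFiniteMeasureOnCompacts μ]
    [NormedAddCommGroup E] {f : X → E} (hf : Continuous f) (hs : HasCompactSupport f) :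
    Integrable (fun x => ‖f x‖ ^ 2) μ := by
  have h : HasCompactSupport fun x => ‖f x‖ ^ 2 :=
    hs.comp_left (g := fun z : E => ‖z‖ ^ 2) (by simp)
  exact (hf.norm.pow 2).integrable_of_hasCompactSupport h

section Rotation

theorem rot_zero (p : ℝ × ℝ) : rot 0 p = p := by simp [rot]

theorem rot_neg_rot (ϑ : ℝ) (p : ℝ × ℝ) : rot (-ϑ) (rot ϑ p) = p := by
  have h := Real.sin_sq_add_cos_sq ϑ
  ext
  · simp only [rot, Real.cos_neg, Real.sin_neg]; linear_combination p.1 * h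
  · simp only [rot, Real.cos_neg, Real.sin_neg]; linear_combination p.2 * h

theorem rot_rot_neg (ϑ : ℝ) (p : ℝ × ℝ) : rot ϑ (rot (-ϑ) p) = p := by
  simpa using rot_neg_rot (-ϑ) p

theorem map_rot_volume (ϑ : ℝ) : Measure.map (rot ϑ) volume = (volume : Measure (ℝ × ℝ)) := by
  set L := Matrix.toLin (Module.Basis.finTwoProd ℝ) (Module.Basis.finTwoProd ℝ)
    !![Real.cos ϑ, Real.sin ϑ; -Real.sin ϑ, Real.cos ϑ] with hL
  have hdet : LinearMap.det L = 1 := by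
    rw [hL, LinearMap.det_toLin, Matrix.det_fin_two_of]
    linear_combination Real.sin_sq_add_cos_sq ϑ
  have hrot : rot ϑ = L := by
    ext p
    · simp only [hL, Matrix.toLin_finTwoProd_apply, rot]; ring
    · simp only [hL, Matrix.toLin_finTwoProd_apply, rot]; ring
  rw [hrot, Measure.map_linearMap_addHaar_eq_smul_addHaar _ (by rw [hdet]; exact one_ne_zero), hdet]
  simp

/-- The homeomorphism of `ℝ × ℝ²` rotating the slice at `x₁` by the angle `g x₁`. -/
def twistHomeomorph (g : ℝ → ℝ) (hg : Continuous g) : (ℝ × ℝ × ℝ) ≃ₜ (ℝ × ℝ × ℝ) where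
  toFun x := (x.1, rot (g x.1) x.2)
  invFun x := (x.1, rot (-g x.1) x.2)
  left_inv x := by simp [rot_neg_rot]
  right_inv x := by simp [rot_rot_neg]
  continuous_toFun := by unfold rot; fun_prop
  continuous_invFun := by unfold rot; fun_prop

theorem measurePreserving_twistHomeomorph (g : ℝ → ℝ) (hg : Continuous g) :
    MeasurePreserving (twistHomeomorph g hg) := by
  have h : Measurable (Function.uncurry fun (t : ℝ) (p : ℝ × ℝ) => rot (g t) p) :=
    ((twistHomeomorph g hg).continuous.snd).measurable
  exact (MeasurePreserving.id volume).skew_product h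
    (Filter.Eventually.of_forall fun t => map_rot_volume (g t))

theorem twistHomeomorph_preimage_Omega0 {g : ℝ → ℝ} (hg : Continuous g) {ω : Set (ℝ × ℝ)}
    (hrot : ∀ t, rot (g t) '' ω = ω) :
    twistHomeomorph g hg ⁻¹' Omega0 ω = Omega0 ω := by
  ext x
  change rot (g x.1) x.2 ∈ ω ↔ x.2 ∈ ω
  constructor
  · intro h
    rw [← hrot x.1] at h
    obtain ⟨p, hp, hpx⟩ := h
    have := congrArg (rot (-g x.1)) hpx
    rw [rot_neg_rot, rot_neg_rot] at this
    exact this ▸ hp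
  · intro h
    rw [← hrot x.1]
    exact mem_image_of_mem _ h

theorem setIntegral_comp_twistHomeomorph {g : ℝ → ℝ} (hg : Continuous g) {ω : Set (ℝ × ℝ)}
    (hrot : ∀ t, rot (g t) '' ω = ω) (h : ℝ × ℝ × ℝ → ℝ) :
    ∫ x in Omega0 ω, h (twistHomeomorph g hg x) = ∫ x in Omega0 ω, h x := by
  have := (measurePreserving_twistHomeomorph g hg).setIntegral_preimage_emb
    (twistHomeomorph g hg).measurableEmbedding h (Omega0 ω)
  rwa [twistHomeomorph_preimage_Omega0 hg hrot] at this

end Rotation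

theorem Omega0_eq_prod (ω : Set (ℝ × ℝ)) : Omega0 ω = univ ×ˢ ω := by
  ext x; simp [Omega0]

theorem setIntegral_Omega0_mul (ω : Set (ℝ × ℝ)) (u : ℝ → ℝ) (v : ℝ × ℝ → ℝ) :
    ∫ x in Omega0 ω, u x.1 * v x.2 = (∫ t, u t) * ∫ p in ω, v p := by
  rw [Omega0_eq_prod, Measure.volume_eq_prod, setIntegral_prod_mul, setIntegral_univ]

theorem integrableOn_Omega0_mul {ω : Set (ℝ × ℝ)} {u : ℝ → ℝ} {v : ℝ × ℝ → ℝ}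
    (hu : Integrable u) (hv : Integrable v) :
    IntegrableOn (fun x : ℝ × ℝ × ℝ => u x.1 * v x.2) (Omega0 ω) :=
  (hu.mul_prod hv).integrableOn

/-- A product function `φ ⊗ f` rotated along the axis by the angle `g`. -/
def twistedProduct (φ g : ℝ → ℝ) (f : ℝ × ℝ → ℂ) (x : ℝ × ℝ × ℝ) : ℂ :=
  φ x.1 • f (rot (g x.1) x.2)

section TwistedProduct

variable {φ g : ℝ → ℝ} {f : ℝ × ℝ → ℂ}

theorem isTest3_twistedProduct {ω : Set (ℝ × ℝ)} (hφ : ContDiff ℝ (⊤ : ℕ∞) φ)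
    (hφs : HasCompactSupport φ) (hg : ContDiff ℝ (⊤ : ℕ∞) g) (hf : IsTest2 ω f)
    (hrot : ∀ t, rot (g t) '' ω = ω) : IsTest3 (Omega0 ω) (twistedProduct φ g f) := by
  set e := twistHomeomorph g hg.continuous with he
  set K := e ⁻¹' (tsupport φ ×ˢ tsupport f) with hK
  have hKc : IsCompact K := e.isCompact_preimage.2 (hφs.isCompact.prod hf.2.1.isCompact)
  have hzero : ∀ x ∉ K, twistedProduct φ g f x = 0 := by
    intro x hx
    by_contra hne
    refine hx ⟨subset_tsupport _ fun h => hne ?_, subset_tsupport _ fun h => hne ?_⟩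
    · have h' : φ x.1 = 0 := h
      simp [twistedProduct, h']
    · have h' : f (rot (g x.1) x.2) = 0 := h
      simp [twistedProduct, h']
  refine ⟨?_, HasCompactSupport.intro hKc hzero, ?_⟩
  · have h1 : ContDiff ℝ (⊤ : ℕ∞) fun x : ℝ × ℝ × ℝ => rot (g x.1) x.2 := by
      have hg' : ContDiff ℝ (⊤ : ℕ∞) fun x : ℝ × ℝ × ℝ => g x.1 := hg.comp contDiff_fst
      have hc := Real.contDiff_cos.comp hg'
      have hs := Real.contDiff_sin.comp hg'
      have h2 : ContDiff ℝ (⊤ : ℕ∞) fun x : ℝ × ℝ × ℝ => x.2.1 := contDiff_snd.fst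
      have h3 : ContDiff ℝ (⊤ : ℕ∞) fun x : ℝ × ℝ × ℝ => x.2.2 := contDiff_snd.snd
      exact ((h2.mul hc).add (h3.mul hs)).prodMk ((h2.neg.mul hs).add (h3.mul hc))
    exact (hφ.comp contDiff_fst).smul (hf.1.comp h1)
  · have hsub : tsupport (twistedProduct φ g f) ⊆ K :=
      closure_minimal (fun x hx => by_contra fun h => hx (hzero x h)) hKc.isClosed
    intro x hx
    rw [← twistHomeomorph_preimage_Omega0 hg.continuous hrot]
    exact hf.2.2 (hsub hx).2

theorem pd1_twistedProduct (hφ : Differentiable ℝ φ) (hg : Differentiable ℝ g)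
    (hf : Differentiable ℝ f) (x : ℝ × ℝ × ℝ) :
    pd1 (twistedProduct φ g f) x =
      deriv φ x.1 • f (rot (g x.1) x.2)
        + (φ x.1 * deriv g x.1) • pdtau' f (rot (g x.1) x.2) := by
  have hg' := (hg x.1).hasDerivAt
  have hr : HasDerivAt (fun t => rot (g t) x.2)
      (deriv g x.1 * (rot (g x.1) x.2).2, -(deriv g x.1 * (rot (g x.1) x.2).1)) x.1 := by
    refine HasDerivAt.congr_deriv ((((hg'.cos).const_mul x.2.1).add
      ((hg'.sin).const_mul x.2.2)).prodMk
      (((hg'.sin).const_mul (-x.2.1)).add ((hg'.cos).const_mul x.2.2))) ?_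
    ext <;> simp only [rot] <;> ring
  have h := (hφ x.1).hasDerivAt.smul ((hf _).hasFDerivAt.comp_hasDerivAt x.1 hr)
  refine h.deriv.trans ?_
  rw [fderiv_apply_eq_pd (hf _)]
  simp only [pdtau', Complex.real_smul, Function.comp]
  push_cast
  ring

theorem pd2_twistedProduct (hf : Differentiable ℝ f) (x : ℝ × ℝ × ℝ) :
    pd2 (twistedProduct φ g f) x =
      φ x.1 • (Real.cos (g x.1) • pd1' f (rot (g x.1) x.2)
        - Real.sin (g x.1) • pd2' f (rot (g x.1) x.2)) := by
  have hr : HasDerivAt (fun t => rot (g x.1) (t, x.2.2))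
      (Real.cos (g x.1), -Real.sin (g x.1)) x.2.1 := by
    have h1 := ((hasDerivAt_id' x.2.1).mul_const (Real.cos (g x.1))).add_const
      (x.2.2 * Real.sin (g x.1))
    have h2 := ((hasDerivAt_id' x.2.1).fun_neg.mul_const (Real.sin (g x.1))).add_const
      (x.2.2 * Real.cos (g x.1))
    refine (h1.prodMk h2).congr_deriv ?_
    ext <;> simp
  have h := ((hf _).hasFDerivAt.comp_hasDerivAt x.2.1 hr).const_smul (φ x.1)
  refine h.deriv.trans ?_
  rw [fderiv_apply_eq_pd (hf _), neg_smul, ← sub_eq_add_neg]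

theorem pd3_twistedProduct (hf : Differentiable ℝ f) (x : ℝ × ℝ × ℝ) :
    pd3 (twistedProduct φ g f) x =
      φ x.1 • (Real.sin (g x.1) • pd1' f (rot (g x.1) x.2)
        + Real.cos (g x.1) • pd2' f (rot (g x.1) x.2)) := by
  have hr : HasDerivAt (fun t => rot (g x.1) (x.2.1, t))
      (Real.sin (g x.1), Real.cos (g x.1)) x.2.2 := by
    have h1 := ((hasDerivAt_id' x.2.2).mul_const (Real.sin (g x.1))).const_add
      (x.2.1 * Real.cos (g x.1))
    have h2 := ((hasDerivAt_id' x.2.2).mul_const (Real.cos (g x.1))).const_add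
      (-x.2.1 * Real.sin (g x.1))
    refine (h1.prodMk h2).congr_deriv ?_
    ext <;> simp
  have h := ((hf _).hasFDerivAt.comp_hasDerivAt x.2.2 hr).const_smul (φ x.1)
  refine h.deriv.trans ?_
  rw [fderiv_apply_eq_pd (hf _)]

theorem pdtau_twistedProduct (hf : Differentiable ℝ f) (x : ℝ × ℝ × ℝ) :
    pdtau (twistedProduct φ g f) x = φ x.1 • pdtau' f (rot (g x.1) x.2) := by
  rw [pdtau, pd2_twistedProduct hf, pd3_twistedProduct hf, pdtau']
  simp only [rot, Complex.real_smul]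
  push_cast
  ring

theorem norm_sq_rotate (φ ϑ : ℝ) (a b : ℂ) :
    ‖φ • (Real.cos ϑ • a - Real.sin ϑ • b)‖ ^ 2 + ‖φ • (Real.sin ϑ • a + Real.cos ϑ • b)‖ ^ 2
      = φ ^ 2 * (‖a‖ ^ 2 + ‖b‖ ^ 2) := by
  simp only [Complex.sq_norm, Complex.normSq_apply, Complex.smul_re, Complex.smul_im,
    Complex.add_re, Complex.add_im, Complex.sub_re, Complex.sub_im, smul_eq_mul]
  linear_combination (φ ^ 2 * (a.re ^ 2 + a.im ^ 2 + b.re ^ 2 + b.im ^ 2)) *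
    Real.sin_sq_add_cos_sq ϑ

theorem norm_add_sq_le_two_mul {E : Type*} [SeminormedAddCommGroup E] (a b : E) :
    ‖a + b‖ ^ 2 ≤ 2 * ‖a‖ ^ 2 + 2 * ‖b‖ ^ 2 := by
  nlinarith [norm_add_le a b, norm_nonneg (a + b), sq_nonneg (‖a‖ - ‖b‖)]

theorem Qform_twistedProduct_le {ω : Set (ℝ × ℝ)} (hφ : ContDiff ℝ (⊤ : ℕ∞) φ)
    (hφs : HasCompactSupport φ) (hg : ContDiff ℝ (⊤ : ℕ∞) g) (hf : IsTest2 ω f)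
    (hrot : ∀ t, rot (g t) '' ω = ω) {θ : ℝ → ℝ} {δ : ℝ}
    (hδ : ∀ t, φ t ≠ 0 → |deriv g t - deriv θ t| ≤ δ) :
    Qform θ ω (twistedProduct φ g f) ≤
      2 * (∫ t, deriv φ t ^ 2) * (∫ p in ω, ‖f p‖ ^ 2)
      + 2 * δ ^ 2 * (∫ t, φ t ^ 2) * (∫ p in ω, ‖pdtau' f p‖ ^ 2)
      + (∫ t, φ t ^ 2) * ∫ p in ω, (‖pd1' f p‖ ^ 2 + ‖pd2' f p‖ ^ 2) := by
  have hfd := hf.differentiable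
  have hφd : Differentiable ℝ φ := hφ.differentiable (by simp)
  have hgd : Differentiable ℝ g := hg.differentiable (by simp)
  set e := twistHomeomorph g hg.continuous with he
  have iφ : Integrable fun t => φ t ^ 2 := by
    simpa using integrable_norm_sq (μ := volume) hφ.continuous hφs
  have iφ' : Integrable fun t => deriv φ t ^ 2 := by
    simpa using integrable_norm_sq (μ := volume) (hφ.continuous_deriv (by simp)) hφs.deriv
  have if0 : Integrable fun p => ‖f p‖ ^ 2 := integrable_norm_sq hf.1.continuous hf.2.1
  have ift : Integrable fun p => ‖pdtau' f p‖ ^ 2 :=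
    integrable_norm_sq hf.continuous_pdtau' hf.hasCompactSupport_pdtau'
  have ifg : Integrable fun p => ‖pd1' f p‖ ^ 2 + ‖pd2' f p‖ ^ 2 :=
    (integrable_norm_sq hf.continuous_pd1' hf.hasCompactSupport_pd1').add
      (integrable_norm_sq hf.continuous_pd2' hf.hasCompactSupport_pd2')
  have i1 := integrableOn_Omega0_mul (ω := ω) (iφ'.const_mul 2) if0
  have i2 := integrableOn_Omega0_mul (ω := ω) (iφ.const_mul (2 * δ ^ 2)) ift
  have i3 := integrableOn_Omega0_mul (ω := ω) iφ ifg
  set H : ℝ × ℝ × ℝ → ℝ := fun x =>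
    (2 * deriv φ x.1 ^ 2) * ‖f x.2‖ ^ 2 + (2 * δ ^ 2 * φ x.1 ^ 2) * ‖pdtau' f x.2‖ ^ 2
      + φ x.1 ^ 2 * (‖pd1' f x.2‖ ^ 2 + ‖pd2' f x.2‖ ^ 2) with hH
  have iH : IntegrableOn H (Omega0 ω) := (i1.add i2).add i3
  have iHe : IntegrableOn (fun x => H (e x)) (Omega0 ω) := by
    have := (measurePreserving_twistHomeomorph g hg.continuous).integrableOn_comp_preimage
      e.measurableEmbedding (f := H) (s := Omega0 ω)
    rw [twistHomeomorph_preimage_Omega0 hg.continuous hrot] at this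
    exact this.2 iH
  have hle : Qform θ ω (twistedProduct φ g f) ≤ ∫ x in Omega0 ω, H (e x) := by
    refine integral_mono_of_nonneg (Filter.Eventually.of_forall fun x => by positivity) iHe
      (Filter.Eventually.of_forall fun x => ?_)
    change _ + _ + _ ≤ H (x.1, rot (g x.1) x.2)
    rw [pd1_twistedProduct hφd hgd hfd, pdtau_twistedProduct hfd, pd2_twistedProduct hfd,
      pd3_twistedProduct hfd, add_assoc, norm_sq_rotate]
    refine add_le_add ?_ le_rfl
    set q := rot (g x.1) x.2
    have hrw : deriv φ x.1 • f q + (φ x.1 * deriv g x.1) • pdtau' f q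
        - deriv θ x.1 • φ x.1 • pdtau' f q
        = deriv φ x.1 • f q + (φ x.1 * (deriv g x.1 - deriv θ x.1)) • pdtau' f q := by
      module
    rw [hrw]
    refine (norm_add_sq_le_two_mul _ _).trans ?_
    rw [norm_smul, norm_smul, mul_pow, mul_pow, Real.norm_eq_abs, Real.norm_eq_abs, sq_abs,
      sq_abs, mul_pow]
    have key : φ x.1 ^ 2 * (deriv g x.1 - deriv θ x.1) ^ 2 ≤ δ ^ 2 * φ x.1 ^ 2 := by
      by_cases h0 : φ x.1 = 0
      · simp [h0]
      · rw [mul_comm]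
        gcongr ?_ * _
        exact sq_le_sq' (abs_le.1 (hδ _ h0)).1 (abs_le.1 (hδ _ h0)).2
    have := mul_le_mul_of_nonneg_right key (sq_nonneg ‖pdtau' f q‖)
    change _ ≤ (2 * deriv φ x.1 ^ 2) * ‖f q‖ ^ 2 + (2 * δ ^ 2 * φ x.1 ^ 2) * ‖pdtau' f q‖ ^ 2
    linarith
  refine hle.trans (le_of_eq ?_)
  rw [setIntegral_comp_twistHomeomorph hg.continuous hrot H]
  have hsum : ∫ x in Omega0 ω, H x = _ := integral_add (i1.add i2) i3
  rw [hsum, integral_add i1 i2, setIntegral_Omega0_mul ω (fun t => 2 * deriv φ t ^ 2) fun p => ‖f p‖ ^ 2,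
    setIntegral_Omega0_mul ω (fun t => 2 * δ ^ 2 * φ t ^ 2) fun p => ‖pdtau' f p‖ ^ 2,
    setIntegral_Omega0_mul ω (fun t => φ t ^ 2) fun p => ‖pd1' f p‖ ^ 2 + ‖pd2' f p‖ ^ 2,
    integral_const_mul, integral_const_mul]

theorem setIntegral_weight_norm_sq_twistedProduct {ω : Set (ℝ × ℝ)} (hg : Continuous g)
    (hrot : ∀ t, rot (g t) '' ω = ω) (w : ℝ → ℝ) :
    ∫ x in Omega0 ω, w x.1 * ‖twistedProduct φ g f x‖ ^ 2
      = (∫ t, w t * φ t ^ 2) * ∫ p in ω, ‖f p‖ ^ 2 := by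
  rw [← setIntegral_Omega0_mul]
  refine Eq.trans ?_ (setIntegral_comp_twistHomeomorph hg hrot
    fun x => (w x.1 * φ x.1 ^ 2) * ‖f x.2‖ ^ 2)
  refine integral_congr_ae (Filter.Eventually.of_forall fun x => ?_)
  change w x.1 * ‖φ x.1 • f (rot (g x.1) x.2)‖ ^ 2
    = (w x.1 * φ x.1 ^ 2) * ‖f (rot (g x.1) x.2)‖ ^ 2
  rw [norm_smul, mul_pow, Real.norm_eq_abs, sq_abs, mul_assoc]

end TwistedProduct

/-- One-dimensional cut-offs violate every Hardy inequality with weight `(1 + t²)⁻¹`. -/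
theorem exists_cutoff_no_hardy {c : ℝ} (hc : 0 < c) :
    ∃ φ : ℝ → ℝ, ContDiff ℝ (⊤ : ℕ∞) φ ∧ HasCompactSupport φ ∧
      ∫ t, deriv φ t ^ 2 < c * ∫ t, (1 + t ^ 2)⁻¹ * φ t ^ 2 := by
  let b : ContDiffBump (0 : ℝ) := ⟨1, 2, one_pos, one_lt_two⟩
  have hb : ContDiff ℝ (⊤ : ℕ∞) b := b.contDiff
  set A := ∫ t, deriv b t ^ 2 with hA
  have hA0 : 0 ≤ A := integral_nonneg fun t => sq_nonneg _
  obtain ⟨n, hn⟩ : ∃ n : ℕ, 2 * A / c < n := exists_nat_gt _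
  set r : ℝ := n + 1 with hr
  have hr1 : 1 ≤ r := by simp [hr]
  have hr0 : 0 < r := by linarith
  have hφ : ContDiff ℝ (⊤ : ℕ∞) fun t => b (t / r) := hb.comp (contDiff_id.div_const r)
  have hφs : HasCompactSupport fun t => b (t / r) := by
    refine HasCompactSupport.intro (isCompact_Icc (a := -(2 * r)) (b := 2 * r)) fun t ht => ?_
    refine b.zero_of_le_dist ?_
    change 2 ≤ _
    rw [dist_zero_right, Real.norm_eq_abs, abs_div, abs_of_pos hr0, le_div_iff₀ hr0]
    by_contra! h
    exact ht (abs_le.1 h.le)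
  refine ⟨_, hφ, hφs, ?_⟩
  have hderiv : ∀ t, deriv (fun t => b (t / r)) t ^ 2 = (r ^ 2)⁻¹ * (deriv b (t / r)) ^ 2 := by
    intro t
    have h := (hb.differentiable (by simp) (t / r)).hasDerivAt.comp t
      ((hasDerivAt_id t).div_const r)
    rw [show deriv (fun t => b (t / r)) t = _ from h.deriv]
    field_simp
  have hint : ∫ t, deriv (fun t => b (t / r)) t ^ 2 = r⁻¹ * A := by
    simp_rw [hderiv]
    rw [integral_const_mul, Measure.integral_comp_div (fun t => deriv b t ^ 2), ← hA,
      abs_of_pos hr0, smul_eq_mul]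
    field_simp
  have hcont : Continuous fun t : ℝ => (1 + t ^ 2)⁻¹ * b (t / r) ^ 2 :=
    (Continuous.inv₀ (by fun_prop) fun t => by positivity).mul (hφ.continuous.pow 2)
  have hi : Integrable fun t : ℝ => (1 + t ^ 2)⁻¹ * b (t / r) ^ 2 := by
    refine hcont.integrable_of_hasCompactSupport (hφs.mono fun t ht h => ht ?_)
    simp [show b (t / r) = 0 from h]
  have hlow : (1 / 2 : ℝ) ≤ ∫ t, (1 + t ^ 2)⁻¹ * b (t / r) ^ 2 := by
    have h1 : ∫ _ in Icc (0 : ℝ) 1, (1 / 2 : ℝ) ≤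
        ∫ t in Icc (0 : ℝ) 1, (1 + t ^ 2)⁻¹ * b (t / r) ^ 2 := by
      refine setIntegral_mono_on (by simp) hi.integrableOn measurableSet_Icc fun t ht => ?_
      have hone : b (t / r) = 1 := by
        refine b.one_of_mem_closedBall ?_
        change _ ≤ (1 : ℝ)
        rw [dist_zero_right, Real.norm_eq_abs, abs_div, abs_of_pos hr0, div_le_one hr0,
          abs_of_nonneg ht.1]
        exact ht.2.trans hr1
      rw [hone, one_pow, mul_one, one_div]
      exact inv_anti₀ (by positivity) (by nlinarith [ht.1, ht.2])
    have h2 := setIntegral_le_integral (s := Icc (0 : ℝ) 1) hi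
      (Filter.Eventually.of_forall fun t => by positivity)
    simpa using h1.trans h2
  rw [hint]
  have h3 : r⁻¹ * A < c * (1 / 2) := by
    rw [div_lt_iff₀ hc] at hn
    rw [inv_mul_lt_iff₀ hr0]
    nlinarith
  nlinarith

/-- The derivative of a `C¹` function is uniformly approximated on compacts by derivatives of
smooth functions. -/
theorem exists_contDiff_deriv_near {θ : ℝ → ℝ} (hθ : ContDiff ℝ 1 θ) {K : Set ℝ}
    (hK : IsCompact K) {δ : ℝ} (hδ : 0 < δ) :
    ∃ g : ℝ → ℝ, ContDiff ℝ (⊤ : ℕ∞) g ∧ ∀ t ∈ K, |deriv g t - deriv θ t| ≤ δ := by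
  obtain ⟨R, hR⟩ := hK.isBounded.subset_closedBall 0
  rw [Real.closedBall_eq_Icc] at hR
  obtain ⟨P, hP⟩ := exists_polynomial_near_of_continuousOn (0 - R) (0 + R) (deriv θ)
    (hθ.continuous_deriv le_rfl).continuousOn δ hδ
  have hd : ∀ t, HasDerivAt (fun u => ∫ s in (0 : ℝ)..u, P.eval s) (P.eval t) t := fun t =>
    intervalIntegral.integral_hasDerivAt_right (P.continuous.intervalIntegrable _ _)
      (P.continuous.stronglyMeasurableAtFilter _ _) P.continuous.continuousAt
  refine ⟨fun u => ∫ s in (0 : ℝ)..u, P.eval s, ?_, fun t ht => ?_⟩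
  · rw [contDiff_infty_iff_deriv]
    refine ⟨fun t => (hd t).differentiableAt, ?_⟩
    rw [funext fun t => (hd t).deriv]
    simpa using P.contDiff_aeval (𝕜 := ℝ) (⊤ : ℕ∞)
  · rw [(hd t).deriv]
    exact (hP t (hR ht)).le

theorem Untwisted.exists_contDiff_rotation {θ : ℝ → ℝ} {ω : Set (ℝ × ℝ)} (hut : Untwisted θ ω)
    (hθ : ContDiff ℝ 1 θ) {K : Set ℝ} (hK : IsCompact K) {δ : ℝ} (hδ : 0 < δ) :
    ∃ g : ℝ → ℝ, ContDiff ℝ (⊤ : ℕ∞) g ∧ (∀ t, rot (g t) '' ω = ω) ∧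
      ∀ t ∈ K, |deriv g t - deriv θ t| ≤ δ := by
  rcases hut with hconst | hrot
  · refine ⟨fun _ => 0, contDiff_const, fun _ => ?_, fun t _ => ?_⟩
    · simp [funext rot_zero]
    · rw [show θ = fun _ => θ 0 from funext fun t => hconst t 0]
      simpa using hδ.le
  · obtain ⟨g, hg, hgδ⟩ := exists_contDiff_deriv_near hθ hK hδ
    exact ⟨g, hg, fun t => hrot _, hgδ⟩

theorem IsTest2.integral_norm_sq_pos {ω : Set (ℝ × ℝ)} {f : ℝ × ℝ → ℂ} (hf : IsTest2 ω f)
    (h0 : f ≠ 0) : 0 < ∫ p in ω, ‖f p‖ ^ 2 := by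
  obtain ⟨x, hx⟩ := Function.ne_iff.1 h0
  rw [setIntegral_eq_integral_of_forall_compl_eq_zero fun p hp => by
    rw [image_eq_zero_of_notMem_tsupport fun h => hp (hf.2.2 h)]; simp]
  refine Continuous.integral_pos_of_hasCompactSupport_nonneg_nonzero (x := x)
    (hf.1.continuous.norm.pow 2) (hf.2.1.comp_left (g := fun z : ℂ => ‖z‖ ^ 2) (by simp))
    (fun p => by positivity) ?_
  simpa using hx

theorem exists_isTest2_ne_zero {ω : Set (ℝ × ℝ)} (hω : IsOpen ω) (hne : ω.Nonempty) :
    ∃ f, IsTest2 ω f ∧ f ≠ 0 := by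
  obtain ⟨x, hx⟩ := hne
  obtain ⟨u, hus, huc, hu, -, hux⟩ := exists_contDiff_tsupport_subset (n := ⊤) (hω.mem_nhds hx)
  refine ⟨fun p => (u p : ℂ), ⟨Complex.ofRealCLM.contDiff.comp hu,
    huc.comp_left (g := fun t : ℝ => (t : ℂ)) (by simp), ?_⟩, fun h => ?_⟩
  · exact (tsupport_comp_subset (g := fun t : ℝ => (t : ℂ)) (by simp) u).trans hus
  · have := congrFun h x
    simp [hux] at this

theorem exists_near_E1 {ω : Set (ℝ × ℝ)} (hω : IsOpen ω) (hne : ω.Nonempty) {ε : ℝ}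
    (hε : 0 < ε) :
    ∃ f, IsTest2 ω f ∧ 0 < ∫ p in ω, ‖f p‖ ^ 2 ∧
      ∫ p in ω, (‖pd1' f p‖ ^ 2 + ‖pd2' f p‖ ^ 2) < (E1 ω + ε) * ∫ p in ω, ‖f p‖ ^ 2 := by
  obtain ⟨f₀, hf₀, hf₀'⟩ := exists_isTest2_ne_zero hω hne
  have hE := lt_add_of_pos_right (E1 ω) hε
  conv_lhs at hE => unfold E1
  obtain ⟨_, ⟨f, hf, hf', rfl⟩, hlt⟩ :=
    exists_lt_of_csInf_lt (by exact ⟨_, f₀, hf₀, hf₀', rfl⟩) hE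
  have hpos := hf.integral_norm_sq_pos hf'
  exact ⟨f, hf, hpos, (div_lt_iff₀ hpos).1 hlt⟩

/-- in an untwisted tube no Hardy inequality holds: for every c > 0
there is a test function ψ with Q_θ[ψ] − E₁∫|ψ|² < c ∫ (1+x₁²)⁻¹ |ψ|². -/
theorem no_hardy_untwisted
    (ω : Set (ℝ × ℝ)) (hω_open : IsOpen ω) (hω_bdd : Bornology.IsBounded ω)
    (hω_conn : IsConnected ω)
    (θ : ℝ → ℝ) (hθ : ContDiff ℝ 1 θ) (hθ' : ∃ M : ℝ, ∀ t : ℝ, |deriv θ t| ≤ M)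
    (hut : Untwisted θ ω) :
    ∀ c : ℝ, 0 < c → ∃ ψ : ℝ × ℝ × ℝ → ℂ, IsTest3 (Omega0 ω) ψ ∧
      Qform θ ω ψ - E1 ω * ∫ x in Omega0 ω, ‖ψ x‖ ^ 2
        < c * ∫ x in Omega0 ω, (1 + x.1 ^ 2)⁻¹ * ‖ψ x‖ ^ 2 := by
  intro c hc
  obtain ⟨φ, hφ, hφs, hlt⟩ := exists_cutoff_no_hardy (c := c / 4) (by positivity)
  set A := ∫ t, deriv φ t ^ 2 with hA
  set B := ∫ t, φ t ^ 2 with hB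
  set W := ∫ t, (1 + t ^ 2)⁻¹ * φ t ^ 2 with hW
  have hA0 : 0 ≤ A := integral_nonneg fun t => sq_nonneg _
  have hB0 : 0 ≤ B := integral_nonneg fun t => sq_nonneg _
  have hcW : 0 < c * W := by linarith
  obtain ⟨f, hf, hF, hD⟩ := exists_near_E1 hω_open hω_conn.nonempty
    (ε := c * W / (4 * (B + 1))) (by positivity)
  set F := ∫ p in ω, ‖f p‖ ^ 2 with hFdef
  set D := ∫ p in ω, (‖pd1' f p‖ ^ 2 + ‖pd2' f p‖ ^ 2) with hDdef
  set T := ∫ p in ω, ‖pdtau' f p‖ ^ 2 with hT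
  have hT0 : 0 ≤ T := integral_nonneg fun p => sq_nonneg _
  have hκ : 0 < c * W * F / (8 * (B * T + 1)) := by positivity
  obtain ⟨g, hg, hrot, hgδ⟩ := hut.exists_contDiff_rotation hθ hφs.isCompact (Real.sqrt_pos.2 hκ)
  refine ⟨twistedProduct φ g f, isTest3_twistedProduct hφ hφs hg hf hrot, ?_⟩
  have hQ := Qform_twistedProduct_le (θ := θ) hφ hφs hg hf hrot
    fun t ht => hgδ t (subset_tsupport _ ht)
  rw [Real.sq_sqrt hκ.le, ← hA, ← hB, ← hFdef, ← hDdef, ← hT] at hQ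
  have hN := setIntegral_weight_norm_sq_twistedProduct (φ := φ) (f := f) hg.continuous hrot
    fun _ => 1
  simp only [one_mul] at hN
  rw [setIntegral_weight_norm_sq_twistedProduct hg.continuous hrot fun t => (1 + t ^ 2)⁻¹, hN,
    ← hB, ← hW, ← hFdef]
  have h1 : A * F < c / 4 * W * F := mul_lt_mul_of_pos_right hlt hF
  have h2 : B * D ≤ B * (E1 ω * F) + c * W * F / 4 := by
    have h := mul_le_mul_of_nonneg_left hD.le hB0
    have h' : B * (c * W / (4 * (B + 1))) ≤ c * W / 4 := by
      rw [mul_div_assoc', div_le_div_iff₀ (by positivity) (by positivity)]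
      nlinarith
    nlinarith [mul_le_mul_of_nonneg_right h' hF.le]
  have h3 : 2 * (c * W * F / (8 * (B * T + 1))) * B * T ≤ c * W * F / 4 := by
    have hBT : 0 ≤ B * T := mul_nonneg hB0 hT0
    have hcWF : 0 < c * W * F := by positivity
    rw [show 2 * (c * W * F / (8 * (B * T + 1))) * B * T
      = (c * W * F * (B * T)) / (4 * (B * T + 1)) by field_simp; ring,
      div_le_div_iff₀ (by positivity) (by positivity)]
    nlinarith
  linarith
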